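/- Let f : ℝⁿ × ℝᵏ → ℝ be differentiable and biconvex on ℝⁿ × ℝᵏ. Then a point (x⋆, y⋆) ∈ ℝⁿ × ℝᵏ is partially optimal (i.e., f(x⋆, y⋆) ≤ f(x, y⋆) for all x ∈ ℝⁿ and f(x⋆, y⋆) ≤ f(x⋆, y) for all y ∈ ℝᵏ) if and only if (x⋆, y⋆) is a stationary point of f, i.e., the total derivative of f at (x⋆, y⋆) is zero. -/

import Mathlib

theorem convex_min_of_hasFDerivAt_zero {E : Type*} [NormedAddCommGroup E] [NormedSpace ℝ E]
    (g : E → ℝ) (hg : ConvexOn ℝ Set.univ g) (a : E)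
    (h : HasFDerivAt g (0 : E →L[ℝ] ℝ) a) (b : E) : g a ≤ g b := by
  have hc : ConvexOn ℝ Set.univ (g ∘ AffineMap.lineMap (k := ℝ) a b) := by
    simpa using hg.comp_affineMap (AffineMap.lineMap (k := ℝ) a b)
  have h' : HasFDerivAt g (0 : E →L[ℝ] ℝ) (AffineMap.lineMap (k := ℝ) a b (0 : ℝ)) := by
    simpa using h
  have hd : HasDerivAt (g ∘ AffineMap.lineMap (k := ℝ) a b) 0 (0 : ℝ) := by
    simpa using h'.comp_hasDerivAt (0 : ℝ) (AffineMap.hasDerivAt_lineMap (a := a) (b := b))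
  have := hc.le_slope_of_hasDerivAt (Set.mem_univ 0) (Set.mem_univ 1) one_pos hd
  simpa [slope_def_field] using this

theorem partially_optimal_iff_stationary {n k : ℕ}
    (f : (Fin n → ℝ) × (Fin k → ℝ) → ℝ)
    (hdiff : Differentiable ℝ f)
    (hbcvx₁ : ∀ y : Fin k → ℝ, ConvexOn ℝ Set.univ (fun x => f (x, y)))
    (hbcvx₂ : ∀ x : Fin n → ℝ, ConvexOn ℝ Set.univ (fun y => f (x, y)))
    (xs : Fin n → ℝ) (ys : Fin k → ℝ) :
    ((∀ x : Fin n → ℝ, f (xs, ys) ≤ f (x, ys)) ∧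
     (∀ y : Fin k → ℝ, f (xs, ys) ≤ f (xs, y))) ↔
    fderiv ℝ f (xs, ys) = 0 := by
  have hf := (hdiff (xs, ys)).hasFDerivAt
  have h1 : HasFDerivAt (fun x => f (x, ys))
      ((fderiv ℝ f (xs, ys)).comp (ContinuousLinearMap.inl ℝ _ _)) xs :=
    HasFDerivAt.comp xs hf (hasFDerivAt_prodMk_left xs ys)
  have h2 : HasFDerivAt (fun y => f (xs, y))
      ((fderiv ℝ f (xs, ys)).comp (ContinuousLinearMap.inr ℝ _ _)) ys :=
    HasFDerivAt.comp ys hf (hasFDerivAt_prodMk_right xs ys)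
  constructor
  · rintro ⟨m1, m2⟩
    have e1 := IsLocalMin.hasFDerivAt_eq_zero (Filter.Eventually.of_forall m1) h1
    have e2 := IsLocalMin.hasFDerivAt_eq_zero (Filter.Eventually.of_forall m2) h2
    exact ContinuousLinearMap.prod_ext (by rw [e1]; simp) (by rw [e2]; simp)
  · intro h
    rw [h, ContinuousLinearMap.zero_comp] at h1 h2
    exact ⟨convex_min_of_hasFDerivAt_zero _ (hbcvx₁ ys) xs h1,
      convex_min_of_hasFDerivAt_zero _ (hbcvx₂ xs) ys h2⟩
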